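/- Let k be an algebraically closed field with char k ≠ 2, V = k⁷, and γ₀ the standard trilinear form γ₀ = f*₁₄₇ + f*₂₄₆ + f*₃₄₅ − f*₁₅₆ − f*₂₃₇. Let G(γ₀) = {g ∈ GL(V) : γ₀(g·u, g·v, g·w) = γ₀(u, v, w) for all u, v, w ∈ V} and SG(γ₀) = G(γ₀) ∩ SL(V). Then for every g ∈ G(γ₀): (det g)³ = 1, and (det g)⁻¹·g lies in SG(γ₀). Consequently the map g ↦ (det g, (det g)⁻¹·g) is a group isomorphism from G(γ₀) onto μ₃ × SG(γ₀), where μ₃ = {ω ∈ k : ω³ = 1} acts on V by scalar multiplication. -/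

import Mathlib

open Module

/-- The alternating trilinear form `f*ₚqᵣ` on `k⁷`: the determinant of the `3×3` matrix of
the `p`-th, `q`-th, `r`-th coordinates (indices `0`-based). -/
def tripleDet {k : Type*} [Field k] (p q r : Fin 7) (u v w : Fin 7 → k) : k :=
  Matrix.det !![u p, u q, u r; v p, v q, v r; w p, w q, w r]

/-- The standard trilinear form `γ₀ = f*₁₄₇ + f*₂₄₆ + f*₃₄₅ − f*₁₅₆ − f*₂₃₇` on `k⁷`
(with `0`-based indices). -/
def gammaStd {k : Type*} [Field k] (u v w : Fin 7 → k) : k :=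
  tripleDet 0 3 6 u v w + tripleDet 1 3 5 u v w + tripleDet 2 3 4 u v w
    - tripleDet 0 4 5 u v w - tripleDet 1 2 6 u v w

open Function

/-- The `6 × 6` Pfaffian `x ↦ Pf (ω (xᵢ, xⱼ))` of an alternating bilinear form `ω`, as an
alternating map; over `ℚ` it is `ω ∧ ω ∧ ω / 6`. -/
def pfaffianSix {R M : Type*} [CommRing R] [AddCommGroup M] [Module R M]
    (ω : M →ₗ[R] M →ₗ[R] R) (hω : ω.IsAlt) : M [⋀^Fin 6]→ₗ[R] R where
  toFun x :=
    ω (x 0) (x 1) * (ω (x 2) (x 3) * ω (x 4) (x 5) - ω (x 2) (x 4) * ω (x 3) (x 5)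
      + ω (x 2) (x 5) * ω (x 3) (x 4))
    - ω (x 0) (x 2) * (ω (x 1) (x 3) * ω (x 4) (x 5) - ω (x 1) (x 4) * ω (x 3) (x 5)
      + ω (x 1) (x 5) * ω (x 3) (x 4))
    + ω (x 0) (x 3) * (ω (x 1) (x 2) * ω (x 4) (x 5) - ω (x 1) (x 4) * ω (x 2) (x 5)
      + ω (x 1) (x 5) * ω (x 2) (x 4))
    - ω (x 0) (x 4) * (ω (x 1) (x 2) * ω (x 3) (x 5) - ω (x 1) (x 3) * ω (x 2) (x 5)
      + ω (x 1) (x 5) * ω (x 2) (x 3))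
    + ω (x 0) (x 5) * (ω (x 1) (x 2) * ω (x 3) (x 4) - ω (x 1) (x 3) * ω (x 2) (x 4)
      + ω (x 1) (x 4) * ω (x 2) (x 3))
  map_update_add' := by
    intro inst x i a b
    obtain rfl : inst = instDecidableEqFin 6 := Subsingleton.elim _ _
    fin_cases i <;> simp <;> ring
  map_update_smul' := by
    intro inst x i c a
    obtain rfl : inst = instDecidableEqFin 6 := Subsingleton.elim _ _
    fin_cases i <;> simp <;> ring
  map_eq_zero_of_eq' x i j h hij := by
    wlog hlt : i < j generalizing i j
    · exact this j i h.symm hij.symm (lt_of_le_of_ne (not_lt.mp hlt) hij.symm)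
    have hself (a : M) : ω a a = 0 := hω a
    have hswap (a b : Fin 6) (_ : b < a) : ω (x a) (x b) = -ω (x b) (x a) := (hω.neg _ _).symm
    fin_cases i <;> fin_cases j <;> first
      | exact absurd hlt (by decide)
      | (simp only [Fin.zero_eta, Fin.mk_one, Fin.reduceFinMk] at h
         simp only [h, hself]
         try simp (disch := decide) only [hswap]
         ring)

section Pfaffian

variable {R M : Type*} [CommRing R] [AddCommGroup M] [Module R M]

/-- The alternating `7`-form `ξ ∧ Pf ω`. -/
def wedgePfaffianSix (ξ : M →ₗ[R] R) (ω : M →ₗ[R] M →ₗ[R] R) (hω : ω.IsAlt) :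
    M [⋀^Fin 7]→ₗ[R] R :=
  AlternatingMap.alternatizeUncurryFin (ξ.smulRight (pfaffianSix ω hω))

theorem wedgePfaffianSix_apply (ξ : M →ₗ[R] R) (ω : M →ₗ[R] M →ₗ[R] R) (hω : ω.IsAlt)
    (x : Fin 7 → M) :
    wedgePfaffianSix ξ ω hω x =
      ∑ i : Fin 7, (-1) ^ (i : ℕ) • (ξ (x i) * pfaffianSix ω hω (i.removeNth x)) := by
  simp [wedgePfaffianSix, AlternatingMap.alternatizeUncurryFin_apply]

end Pfaffian

section Gamma

variable {k : Type*} [Field k]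

theorem gammaStd_apply (u v w : Fin 7 → k) :
    gammaStd u v w =
      (u 0 * v 3 * w 6 - u 0 * v 6 * w 3 - u 3 * v 0 * w 6 + u 3 * v 6 * w 0
        + u 6 * v 0 * w 3 - u 6 * v 3 * w 0)
      + (u 1 * v 3 * w 5 - u 1 * v 5 * w 3 - u 3 * v 1 * w 5 + u 3 * v 5 * w 1
        + u 5 * v 1 * w 3 - u 5 * v 3 * w 1)
      + (u 2 * v 3 * w 4 - u 2 * v 4 * w 3 - u 3 * v 2 * w 4 + u 3 * v 4 * w 2
        + u 4 * v 2 * w 3 - u 4 * v 3 * w 2)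
      - (u 0 * v 4 * w 5 - u 0 * v 5 * w 4 - u 4 * v 0 * w 5 + u 4 * v 5 * w 0
        + u 5 * v 0 * w 4 - u 5 * v 4 * w 0)
      - (u 1 * v 2 * w 6 - u 1 * v 6 * w 2 - u 2 * v 1 * w 6 + u 2 * v 6 * w 1
        + u 6 * v 1 * w 2 - u 6 * v 2 * w 1) := by
  simp only [gammaStd, tripleDet, Matrix.det_fin_three, Matrix.of_apply, Matrix.cons_val]

/-- The bilinear form `γ₀ (u, ·, ·)`. -/
def gammaContract (u : Fin 7 → k) : (Fin 7 → k) →ₗ[k] (Fin 7 → k) →ₗ[k] k :=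
  LinearMap.mk₂ k (gammaStd u)
    (fun _ _ _ => by simp only [gammaStd_apply, Pi.add_apply]; ring)
    (fun _ _ _ => by simp only [gammaStd_apply, Pi.smul_apply, smul_eq_mul]; ring)
    (fun _ _ _ => by simp only [gammaStd_apply, Pi.add_apply]; ring)
    (fun _ _ _ => by simp only [gammaStd_apply, Pi.smul_apply, smul_eq_mul]; ring)

theorem gammaContract_apply (u v w : Fin 7 → k) : gammaContract u v w = gammaStd u v w :=
  rfl

theorem gammaContract_isAlt (u : Fin 7 → k) : (gammaContract u).IsAlt := fun v => by
  rw [gammaContract_apply, gammaStd_apply]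
  ring

/-- The quadratic form attached to `γ₀`. -/
def gammaNorm (u : Fin 7 → k) : k :=
  u 3 ^ 2 + u 0 * u 6 - u 1 * u 5 - u 2 * u 4

/-- The polar form of `gammaNorm`. -/
def gammaPolar (u v : Fin 7 → k) : k :=
  2 * u 3 * v 3 + u 0 * v 6 + u 6 * v 0 - u 1 * v 5 - u 5 * v 1 - u 2 * v 4 - u 4 * v 2

theorem gammaNorm_add (u v : Fin 7 → k) :
    gammaNorm (u + v) = gammaNorm u + gammaNorm v + gammaPolar u v := by
  simp only [gammaNorm, gammaPolar, Pi.add_apply]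
  ring

theorem gammaNorm_smul (c : k) (u : Fin 7 → k) : gammaNorm (c • u) = c ^ 2 * gammaNorm u := by
  simp only [gammaNorm, Pi.smul_apply, smul_eq_mul]
  ring

theorem gammaPolar_sub_left (u v w : Fin 7 → k) :
    gammaPolar (u - v) w = gammaPolar u w - gammaPolar v w := by
  simp only [gammaPolar, Pi.sub_apply]
  ring

theorem gammaPolar_smul_left (c : k) (u v : Fin 7 → k) :
    gammaPolar (c • u) v = c * gammaPolar u v := by
  simp only [gammaPolar, Pi.smul_apply, smul_eq_mul]
  ring

theorem gammaPolar_nondegenerate (h2 : (2 : k) ≠ 0) {u : Fin 7 → k}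
    (h : ∀ v, gammaPolar u v = 0) : u = 0 := by
  have hb (j : Fin 7) := h (Pi.single j 1)
  funext i
  fin_cases i
  · simpa [gammaPolar, Pi.single_apply] using hb 6
  · simpa [gammaPolar, Pi.single_apply] using hb 5
  · simpa [gammaPolar, Pi.single_apply] using hb 4
  · simpa [gammaPolar, Pi.single_apply, h2] using hb 3
  · simpa [gammaPolar, Pi.single_apply] using hb 2
  · simpa [gammaPolar, Pi.single_apply] using hb 1
  · simpa [gammaPolar, Pi.single_apply] using hb 0

/-- Twice the cross product defined by `γ₀` and `gammaPolar`. -/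
def gammaCross (u v : Fin 7 → k) : Fin 7 → k :=
  ![2 * gammaStd u v (Pi.single 6 1), -2 * gammaStd u v (Pi.single 5 1),
    -2 * gammaStd u v (Pi.single 4 1), gammaStd u v (Pi.single 3 1),
    -2 * gammaStd u v (Pi.single 2 1), -2 * gammaStd u v (Pi.single 1 1),
    2 * gammaStd u v (Pi.single 0 1)]

theorem gammaPolar_gammaCross (u v w : Fin 7 → k) :
    gammaPolar (gammaCross u v) w = 2 * gammaStd u v w := by
  simp [gammaPolar, gammaCross, gammaStd_apply]
  ring

theorem gammaNorm_gammaCross (u v : Fin 7 → k) :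
    gammaNorm (gammaCross u v) = gammaPolar u v ^ 2 - 4 * gammaNorm u * gammaNorm v := by
  simp [gammaNorm, gammaPolar, gammaCross, gammaStd_apply]
  ring

theorem wedgePfaffianSix_gammaContract (ξ : (Fin 7 → k) →ₗ[k] k) (u : Fin 7 → k) :
    wedgePfaffianSix ξ (gammaContract u) (gammaContract_isAlt u) (Pi.basisFun k (Fin 7)) =
      gammaNorm u * ξ u := by
  have hu : ξ u = ∑ i, u i * ξ (Pi.single i 1) := by
    conv_lhs => rw [pi_eq_sum_univ' u]
    simp
  rw [hu, wedgePfaffianSix_apply]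
  have hω (i j : Fin 7) : gammaContract u (Pi.single i 1) (Pi.single j 1) =
      !![0, 0, 0, u 6, -u 5, u 4, -u 3;
        0, 0, -u 6, u 5, 0, -u 3, u 2;
        0, u 6, 0, u 4, -u 3, 0, -u 1;
        -u 6, -u 5, -u 4, 0, u 2, u 1, u 0;
        u 5, 0, u 3, -u 2, 0, -u 0, 0;
        -u 4, u 3, 0, -u 1, u 0, 0, 0;
        u 3, -u 2, u 1, -u 0, 0, 0, 0] i j := by
    fin_cases i <;> fin_cases j <;> simp [gammaContract_apply, gammaStd_apply]
  simp only [Fin.sum_univ_seven, pfaffianSix, Pi.basisFun_apply, AlternatingMap.coe_mk,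
    MultilinearMap.coe_mk, Fin.removeNth, hω]
  simp [Fin.succAbove, gammaNorm]
  ring

/-- A linear map preserving `γ₀` scales the quadratic form by the inverse of its determinant. -/
theorem det_mul_gammaNorm_map {g : (Fin 7 → k) →ₗ[k] (Fin 7 → k)} (hg : Injective g)
    (hγ : ∀ u v w, gammaStd (g u) (g v) (g w) = gammaStd u v w) (u : Fin 7 → k) :
    LinearMap.det g * gammaNorm (g u) = gammaNorm u := by
  rcases eq_or_ne u 0 with rfl | hu
  · simp [gammaNorm]
  obtain ⟨i, hi⟩ := Function.ne_iff.mp ((map_ne_zero_iff g hg).mpr hu)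
  let ξ : (Fin 7 → k) →ₗ[k] k := LinearMap.proj i
  let e := Pi.basisFun k (Fin 7)
  have hcomp : (gammaContract (g u)).compl₁₂ g g = gammaContract u :=
    LinearMap.ext₂ fun v w => hγ u v w
  have hpull : wedgePfaffianSix ξ (gammaContract (g u)) (gammaContract_isAlt _) (g ∘ e) =
      wedgePfaffianSix (ξ ∘ₗ g) (gammaContract u) (gammaContract_isAlt _) e := by
    simp only [wedgePfaffianSix_apply, ← hcomp]
    rfl
  rw [AlternatingMap.eq_smul_basis_det e (wedgePfaffianSix ξ _ _), AlternatingMap.smul_apply,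
    e.det_comp, e.det_self, wedgePfaffianSix_gammaContract, wedgePfaffianSix_gammaContract] at hpull
  refine mul_right_cancel₀ (b := ξ (g u)) hi ?_
  simpa [mul_comm, mul_assoc, mul_left_comm] using hpull

theorem det_mul_gammaPolar_map {g : (Fin 7 → k) →ₗ[k] (Fin 7 → k)} (hg : Injective g)
    (hγ : ∀ u v w, gammaStd (g u) (g v) (g w) = gammaStd u v w) (u v : Fin 7 → k) :
    LinearMap.det g * gammaPolar (g u) (g v) = gammaPolar u v := by
  have h := det_mul_gammaNorm_map hg hγ (u + v)
  rw [map_add, gammaNorm_add, gammaNorm_add] at h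
  linear_combination h - det_mul_gammaNorm_map hg hγ u - det_mul_gammaNorm_map hg hγ v

theorem gammaCross_map (h2 : (2 : k) ≠ 0) {g : (Fin 7 → k) →ₗ[k] (Fin 7 → k)} (hg : Bijective g)
    (hγ : ∀ u v w, gammaStd (g u) (g v) (g w) = gammaStd u v w) (u v : Fin 7 → k) :
    gammaCross (g u) (g v) = LinearMap.det g • g (gammaCross u v) := by
  refine sub_eq_zero.mp (gammaPolar_nondegenerate h2 fun w => ?_)
  obtain ⟨w, rfl⟩ := hg.surjective w
  rw [gammaPolar_sub_left, gammaPolar_smul_left, gammaPolar_gammaCross, hγ,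
    det_mul_gammaPolar_map hg.injective hγ, gammaPolar_gammaCross, sub_self]

theorem det_pow_three_eq_one (h2 : (2 : k) ≠ 0) {g : (Fin 7 → k) →ₗ[k] (Fin 7 → k)}
    (hg : Bijective g) (hγ : ∀ u v w, gammaStd (g u) (g v) (g w) = gammaStd u v w) :
    LinearMap.det g ^ 3 = 1 := by
  set d := LinearMap.det g
  let u : Fin 7 → k := Pi.single 0 1
  let v : Fin 7 → k := Pi.single 6 1
  have hval : gammaNorm (gammaCross u v) = 1 := by
    rw [gammaNorm_gammaCross]
    simp [u, v, gammaPolar, gammaNorm]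
  have hmap : gammaNorm (gammaCross (g u) (g v)) = d * gammaNorm (gammaCross u v) := by
    rw [gammaCross_map h2 hg hγ, gammaNorm_smul, pow_two, mul_assoc,
      det_mul_gammaNorm_map hg.injective hγ]
  have hscale : d ^ 2 * gammaNorm (gammaCross (g u) (g v)) = gammaNorm (gammaCross u v) := by
    rw [gammaNorm_gammaCross, gammaNorm_gammaCross, ← det_mul_gammaPolar_map hg.injective hγ u v,
      ← det_mul_gammaNorm_map hg.injective hγ u, ← det_mul_gammaNorm_map hg.injective hγ v]
    ring
  rw [hmap, hval] at hscale
  linear_combination hscale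

theorem gammaStd_smul (c : k) (u v w : Fin 7 → k) :
    gammaStd (c • u) (c • v) (c • w) = c ^ 3 * gammaStd u v w := by
  simp only [gammaStd_apply, Pi.smul_apply, smul_eq_mul]
  ring

theorem gammaStd_smul_map {c : k} (hc : c ^ 3 = 1) {g : (Fin 7 → k) →ₗ[k] (Fin 7 → k)}
    (hγ : ∀ u v w, gammaStd (g u) (g v) (g w) = gammaStd u v w) (u v w : Fin 7 → k) :
    gammaStd ((c • g) u) ((c • g) v) ((c • g) w) = gammaStd u v w := by
  simp only [LinearMap.smul_apply, gammaStd_smul, hc, one_mul, hγ]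

theorem LinearMap.det_smul_eq_mul_of_pow_three_eq_one {c : k} (hc : c ^ 3 = 1)
    (g : (Fin 7 → k) →ₗ[k] (Fin 7 → k)) :
    LinearMap.det (c • g) = c * LinearMap.det g := by
  have h7 : c ^ 7 = c := by linear_combination (c ^ 4 + c) * hc
  rw [LinearMap.det_smul, Module.finrank_fin_fun, h7]

theorem LinearMap.bijective_smul {c : k} (hc : c ≠ 0) {g : (Fin 7 → k) →ₗ[k] (Fin 7 → k)}
    (hg : Bijective g) : Bijective (c • g) :=
  (MulAction.bijective (Units.mk0 c hc)).comp hg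

end Gamma

/-- Every `g ∈ G(γ₀) ⊆ GL₇(k)` has `(det g)³ = 1` and `(det g)⁻¹·g ∈ SG(γ₀)`;
the map `g ↦ (det g, (det g)⁻¹·g)` is a bijection of `G(γ₀)` onto `μ₃ × SG(γ₀)` and is
multiplicative, hence a group isomorphism. -/
theorem stabilizer_decomposition
    {k : Type*} [Field k] [IsAlgClosed k] (hchar : (2 : k) ≠ 0) :
    (∀ g : (Fin 7 → k) →ₗ[k] (Fin 7 → k), Function.Bijective g →
      (∀ u v w : Fin 7 → k, gammaStd (g u) (g v) (g w) = gammaStd u v w) →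
      (LinearMap.det g) ^ 3 = 1 ∧
        Function.Bijective ((LinearMap.det g)⁻¹ • g) ∧
        LinearMap.det ((LinearMap.det g)⁻¹ • g) = 1 ∧
        (∀ u v w : Fin 7 → k,
          gammaStd (((LinearMap.det g)⁻¹ • g) u) (((LinearMap.det g)⁻¹ • g) v)
            (((LinearMap.det g)⁻¹ • g) w) = gammaStd u v w)) ∧
    Set.BijOn
      (fun g : (Fin 7 → k) →ₗ[k] (Fin 7 → k) => (LinearMap.det g, (LinearMap.det g)⁻¹ • g))
      {g | Function.Bijective g ∧
        ∀ u v w : Fin 7 → k, gammaStd (g u) (g v) (g w) = gammaStd u v w}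
      ({ω : k | ω ^ 3 = 1} ×ˢ
        {h : (Fin 7 → k) →ₗ[k] (Fin 7 → k) | Function.Bijective h ∧ LinearMap.det h = 1 ∧
          ∀ u v w : Fin 7 → k, gammaStd (h u) (h v) (h w) = gammaStd u v w}) ∧
    (∀ g h : (Fin 7 → k) →ₗ[k] (Fin 7 → k),
      (Function.Bijective g ∧
        ∀ u v w : Fin 7 → k, gammaStd (g u) (g v) (g w) = gammaStd u v w) →
      (Function.Bijective h ∧
        ∀ u v w : Fin 7 → k, gammaStd (h u) (h v) (h w) = gammaStd u v w) →
      LinearMap.det (g ∘ₗ h) = LinearMap.det g * LinearMap.det h ∧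
        (LinearMap.det (g ∘ₗ h))⁻¹ • (g ∘ₗ h) =
          ((LinearMap.det g)⁻¹ • g) ∘ₗ ((LinearMap.det h)⁻¹ • h)) := by
  have hne {c : k} (hc : c ^ 3 = 1) : c ≠ 0 := by
    rintro rfl
    simp at hc
  have hstab : ∀ g : (Fin 7 → k) →ₗ[k] (Fin 7 → k), Function.Bijective g →
      (∀ u v w : Fin 7 → k, gammaStd (g u) (g v) (g w) = gammaStd u v w) →
      (LinearMap.det g) ^ 3 = 1 ∧
        Function.Bijective ((LinearMap.det g)⁻¹ • g) ∧
        LinearMap.det ((LinearMap.det g)⁻¹ • g) = 1 ∧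
        (∀ u v w : Fin 7 → k,
          gammaStd (((LinearMap.det g)⁻¹ • g) u) (((LinearMap.det g)⁻¹ • g) v)
            (((LinearMap.det g)⁻¹ • g) w) = gammaStd u v w) := by
    intro g hg hγ
    have hd := det_pow_three_eq_one hchar hg hγ
    have hd' : (LinearMap.det g)⁻¹ ^ 3 = 1 := by rw [inv_pow, hd, inv_one]
    refine ⟨hd, LinearMap.bijective_smul (inv_ne_zero (hne hd)) hg, ?_, gammaStd_smul_map hd' hγ⟩
    rw [LinearMap.det_smul_eq_mul_of_pow_three_eq_one hd', inv_mul_cancel₀ (hne hd)]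
  refine ⟨hstab, ⟨?_, ?_, ?_⟩, ?_⟩
  · rintro g ⟨hg, hγ⟩
    exact hstab g hg hγ
  · rintro g ⟨hg, hγ⟩ h - hgh
    obtain ⟨hdet, hsmul⟩ := Prod.mk.inj hgh
    rw [← hdet] at hsmul
    exact smul_right_injective _ (inv_ne_zero (hne (hstab g hg hγ).1)) hsmul
  · rintro ⟨ω, h⟩ ⟨hω : ω ^ 3 = 1, hh, hdet, hγ⟩
    have hdω : LinearMap.det (ω • h) = ω := by
      rw [LinearMap.det_smul_eq_mul_of_pow_three_eq_one hω, hdet, mul_one]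
    refine ⟨ω • h, ⟨LinearMap.bijective_smul (hne hω) hh, gammaStd_smul_map hω hγ⟩, ?_⟩
    simp only [hdω, inv_smul_smul₀ (hne hω)]
  · rintro g h - -
    rw [LinearMap.det_comp, mul_inv, LinearMap.smul_comp, LinearMap.comp_smul, smul_smul]
    exact ⟨rfl, rfl⟩
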